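/- Assume (A), (A+), ℓ ∈ C¹(X) and ℓ Lipschitz on bounded subsets of X. Fix ū, u ∈ 𝒰, x₀ ∈ X and α ≥ 0, and define the cost 𝓘[v] := ℓ(x^v_T) + (α/2)∫_I |v(t)|² dt and the reduced Hamiltonian H̄_t(x, 𝑢) := (α/2)|𝑢|² + 𝑢ᵀ G_t(x)' Dp̄_t(x), where p̄_t := ℓ ∘ Φ̄_{t,T}. Then the exact cost-increment formula holds: 𝓘[u] − 𝓘[ū] = ∫_I ( H̄_t(x^u_t, u(t)) − H̄_t(x^u_t, ū(t)) ) dt. -/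

import Mathlib

open MeasureTheory Set Filter
open scoped RealInnerProductSpace

noncomputable section

/-- `φ` is a mild solution on `[s,T]` with initial data `(s, x)` for the semigroup `S`. -/
def IsMildSol {X : Type*} [NormedAddCommGroup X] [NormedSpace ℝ X]
    (T : ℝ) (S : ℝ → X →L[ℝ] X) (F : ℝ → X → X) (s : ℝ) (x : X) (φ : ℝ → X) : Prop :=
  ContinuousOn φ (Set.Icc s T) ∧
    ∀ t ∈ Set.Icc s T, φ t = S (t - s) x + ∫ τ in s..t, S (t - τ) (F τ (φ τ))

theorem aux_carath {Y Z : Type*} [NormedAddCommGroup Y] [NormedAddCommGroup Z]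
    {μ : Measure ℝ} (h : ℝ → Y → Z)
    (hm : ∀ y, AEStronglyMeasurable (fun t => h t y) μ)
    (hc : ∀ᵐ t ∂μ, Continuous (h t)) {φ : ℝ → Y} (hφ : AEStronglyMeasurable φ μ) :
    AEStronglyMeasurable (fun t => h t (φ t)) μ := by
  have hs : ∀ ψ : SimpleFunc ℝ Y, AEStronglyMeasurable (fun t => h t (ψ t)) μ := by
    intro ψ
    have : (fun t => h t (ψ t)) =
        fun t => ∑ c ∈ ψ.range, (ψ ⁻¹' {c}).indicator (fun t => h t c) t := by
      funext t
      rw [Finset.sum_eq_single (ψ t)]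
      · simp
      · intro b _ hb
        rw [Set.indicator_of_notMem]
        simpa using hb.symm
      · intro hn
        exact absurd (SimpleFunc.mem_range_self ψ t) hn
    rw [this]
    refine Finset.aestronglyMeasurable_fun_sum _ fun c _ => ?_
    exact (hm c).indicator (ψ.measurableSet_preimage _)
  obtain ⟨φ', hφ', he⟩ := hφ
  refine aestronglyMeasurable_of_tendsto_ae atTop (fun n => hs (hφ'.approx n)) ?_
  filter_upwards [hc, he] with t ht het
  rw [het]
  exact (ht.tendsto _).comp (hφ'.tendsto_approx t)

theorem aux_diff {X : Type*} [NormedAddCommGroup X] [NormedSpace ℝ X] [CompleteSpace X]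
    (P : X → X) {L C : ℝ}
    (hL : ∀ x y, ‖P x - P y‖ ≤ L * ‖x - y‖)
    (h2 : ∀ x h k, ‖P (x + h + k) - P (x + h) - P (x + k) + P x‖ ≤ C * ‖h‖ * ‖k‖) (x : X) :
    DifferentiableAt ℝ P x := by
  set Q : X → X := fun h => P (x + h) - P x with hQ
  have hQ2 : ∀ h k, ‖Q (h + k) - Q h - Q k‖ ≤ C * ‖h‖ * ‖k‖ := by
    intro h k
    refine le_trans (le_of_eq ?_) (h2 x h k)
    simp only [hQ]; congr 1; rw [add_assoc]; abel
  have hQL : ∀ h, ‖Q h‖ ≤ L * ‖h‖ := by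
    intro h
    simpa [hQ] using hL (x + h) x
  set a : X → ℕ → X := fun h n => (2 : ℝ) ^ n • Q (((2 : ℝ) ^ n)⁻¹ • h) with ha
  have hstep : ∀ h n, dist (a h n) (a h (n + 1)) ≤ (C * ‖h‖ ^ 2 / 2) / 2 / 2 ^ n := by
    intro h n
    have e1 : ((2 : ℝ) ^ n)⁻¹ • h = ((2 : ℝ) ^ (n + 1))⁻¹ • h + ((2 : ℝ) ^ (n + 1))⁻¹ • h := by
      rw [← add_smul]; congr 1; field_simp; ring
    set k := ((2 : ℝ) ^ (n + 1))⁻¹ • h with hk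
    have e2 : a h n - a h (n + 1) = (2 : ℝ) ^ n • (Q (k + k) - Q k - Q k) := by
      simp only [ha]
      rw [e1, ← hk, pow_succ, mul_smul, two_smul]
      simp only [smul_sub, smul_add]; abel
    rw [dist_eq_norm, e2, norm_smul]
    have hkn : ‖k‖ = ((2 : ℝ) ^ (n + 1))⁻¹ * ‖h‖ := by
      rw [hk, norm_smul]; simp
    have := hQ2 k k
    rw [hkn] at this
    calc ‖(2 : ℝ) ^ n‖ * ‖Q (k + k) - Q k - Q k‖
        ≤ 2 ^ n * (C * (((2 : ℝ) ^ (n + 1))⁻¹ * ‖h‖) * (((2 : ℝ) ^ (n + 1))⁻¹ * ‖h‖)) := by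
          rw [norm_pow, Real.norm_ofNat]; gcongr
      _ = _ := by rw [pow_succ]; field_simp; try norm_num
  have hcs : ∀ h, CauchySeq (a h) := fun h => cauchySeq_of_le_geometric_two (hstep h)
  choose D hD using fun h => cauchySeq_tendsto_of_complete (hcs h)
  have ha0 : ∀ h, a h 0 = Q h := by intro h; simp [ha]
  have hD0 : ∀ h, ‖Q h - D h‖ ≤ C * ‖h‖ ^ 2 / 2 := by
    intro h
    have := dist_le_of_le_geometric_two_of_tendsto₀ (hstep h) (hD h)
    rwa [ha0, dist_eq_norm] at this
  have hDb : ∀ h, ‖D h‖ ≤ L * ‖h‖ := by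
    intro h
    refine le_of_tendsto (hD h).norm (Eventually.of_forall fun n => ?_)
    simp only [ha]
    rw [norm_smul]
    calc ‖(2 : ℝ) ^ n‖ * ‖Q (((2 : ℝ) ^ n)⁻¹ • h)‖
        ≤ 2 ^ n * (L * (((2 : ℝ) ^ n)⁻¹ * ‖h‖)) := by
          rw [norm_pow, Real.norm_ofNat]; gcongr
          refine (hQL _).trans (le_of_eq ?_)
          rw [norm_smul]; simp
      _ = _ := by field_simp
  have hDadd : ∀ h k, D (h + k) = D h + D k := by
    intro h k
    have t1 := ((hD (h + k)).sub (hD h)).sub (hD k)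
    have t2 : Tendsto (fun n => a (h + k) n - a h n - a k n) atTop (nhds 0) := by
      have hz : Tendsto (fun n : ℕ => C * ‖h‖ * ‖k‖ * ((1 / 2 : ℝ)) ^ n) atTop (nhds 0) := by
        simpa using (tendsto_pow_atTop_nhds_zero_of_lt_one (by norm_num : (0:ℝ) ≤ 1/2)
          (by norm_num)).const_mul (C * ‖h‖ * ‖k‖)
      refine squeeze_zero_norm (fun n => ?_) hz
      simp only [ha]
      rw [← smul_sub, ← smul_sub, smul_add, norm_smul]
      calc ‖(2 : ℝ) ^ n‖ * _ ≤ 2 ^ n * (C * (((2 : ℝ) ^ n)⁻¹ * ‖h‖) * (((2 : ℝ) ^ n)⁻¹ * ‖k‖)) := by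
            rw [norm_pow, Real.norm_ofNat]; gcongr
            refine (hQ2 _ _).trans (le_of_eq ?_)
            rw [norm_smul, norm_smul]; simp
        _ = _ := by rw [div_pow, one_pow]; field_simp
    have := tendsto_nhds_unique t1 t2
    rw [sub_sub, sub_eq_zero] at this
    exact this
  have hDc : Continuous D := by
    have hDsub : ∀ h k, D (h - k) = D h - D k := by
      intro h k
      have := hDadd (h - k) k
      rw [sub_add_cancel] at this
      rw [this]; abel
    refine (LipschitzWith.of_dist_le_mul (K := Real.toNNReal L) fun h k => ?_).continuous
    rw [dist_eq_norm, dist_eq_norm, ← hDsub]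
    refine (hDb _).trans ?_
    gcongr
    exact Real.le_coe_toNNReal L
  let A : X →L[ℝ] X := (AddMonoidHom.mk' D hDadd).toRealLinearMap hDc
  have hA : ∀ h, A h = D h := fun h => rfl
  refine HasFDerivAt.differentiableAt (f' := A) ?_
  rw [hasFDerivAt_iff_isLittleO_nhds_zero]
  refine Asymptotics.IsBigO.trans_isLittleO (g := fun h : X => ‖h‖ ^ 2) ?_ ?_
  · refine Asymptotics.IsBigO.of_bound (C / 2) (Eventually.of_forall fun h => ?_)
    have := hD0 h
    rw [hA]
    simp only [hQ] at this
    refine this.trans (le_of_eq ?_)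
    rw [norm_pow, norm_norm]; ring
  · exact Asymptotics.isLittleO_norm_pow_id one_lt_two

theorem aux_gronwall {w : ℝ → ℝ} {s t a K : ℝ} (hst : s ≤ t) (ha : 0 ≤ a) (hK : 0 ≤ K)
    (hw : ContinuousOn w (Icc s t)) (hw0 : ∀ r ∈ Icc s t, 0 ≤ w r)
    (h : ∀ r ∈ Icc s t, w r ≤ a + K * ∫ τ in s..r, w τ) :
    w t ≤ a * Real.exp (K * (t - s)) := by
  set v : ℝ → ℝ := IccExtend hst ((Icc s t).domRestrict w) with hv
  have hvc : Continuous v := (continuousOn_iff_continuous_domRestrict.1 hw).Icc_extend'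
  have hvw : ∀ r ∈ Icc s t, v r = w r := fun r hr => by
    rw [hv, IccExtend_of_mem _ _ hr]; rfl
  have hint : ∀ r ∈ Icc s t, ∫ τ in s..r, w τ = ∫ τ in s..r, v τ := by
    intro r hr
    refine intervalIntegral.integral_congr fun τ hτ => ?_
    rw [uIcc_of_le hr.1] at hτ
    exact (hvw τ ⟨hτ.1, hτ.2.trans hr.2⟩).symm
  set W : ℝ → ℝ := fun r => a + K * ∫ τ in s..r, v τ with hW
  have hd : ∀ r, HasDerivAt W (K * v r) r := fun r =>
    ((hvc.integral_hasStrictDerivAt s r).hasDerivAt.const_mul K).const_add a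
  have hvW : ∀ r ∈ Icc s t, v r ≤ W r := fun r hr => by
    rw [hvw r hr]; simp only [hW]; rw [← hint r hr]; exact h r hr
  have hv0 : ∀ r ∈ Icc s t, 0 ≤ v r := fun r hr => by rw [hvw r hr]; exact hw0 r hr
  have := norm_le_gronwallBound_of_norm_deriv_right_le (f := W) (f' := fun r => K * v r)
    (δ := a) (K := K) (ε := 0) (a := s) (b := t)
    (fun r _ => (hd r).continuousAt.continuousWithinAt)
    (fun r _ => (hd r).hasDerivWithinAt) (by simp [hW, abs_of_nonneg ha])
    (fun r hr => by
      have hr' : r ∈ Icc s t := ⟨hr.1, hr.2.le⟩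
      rw [Real.norm_of_nonneg (mul_nonneg hK (hv0 r hr')), add_zero,
        Real.norm_of_nonneg ((hv0 r hr').trans (hvW r hr'))]
      exact mul_le_mul_of_nonneg_left (hvW r hr') hK) t ⟨hst, le_rfl⟩
  rw [gronwallBound_ε0] at this
  have ht : t ∈ Icc s t := ⟨hst, le_rfl⟩
  rw [← hvw t ht]
  exact (hvW t ht).trans ((Real.le_norm_self _).trans this)

theorem aux_semigroup_bound {X : Type*} [NormedAddCommGroup X] [NormedSpace ℝ X]
    [CompleteSpace X] {T : ℝ} (S : ℝ → X →L[ℝ] X)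
    (hScont : ∀ x : X, ContinuousOn (fun σ => S σ x) (Set.Ici (0 : ℝ))) :
    ∃ C : ℝ, 1 ≤ C ∧ ∀ σ ∈ Icc 0 T, ‖S σ‖ ≤ C := by
  obtain ⟨C, hC⟩ := banach_steinhaus (g := fun σ : Icc (0:ℝ) T => S σ) (fun x => by
    obtain ⟨C, hC⟩ := isCompact_Icc.exists_bound_of_continuousOn
      ((hScont x).mono (Icc_subset_Ici_self : Icc 0 T ⊆ Ici 0))
    exact ⟨C, fun i => hC i i.2⟩)
  exact ⟨max 1 C, le_max_left _ _, fun σ hσ => (hC ⟨σ, hσ⟩).trans (le_max_right _ _)⟩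

theorem aux_second_diff {X Y : Type*} [NormedAddCommGroup X] [NormedSpace ℝ X]
    [NormedAddCommGroup Y] [NormedSpace ℝ Y] (F : X → Y) {M : ℝ}
    (hF : ContDiff ℝ 1 F) (hM : ∀ x y, ‖fderiv ℝ F x - fderiv ℝ F y‖ ≤ M * ‖x - y‖) (x h k : X) :
    ‖F (x + h + k) - F (x + h) - F (x + k) + F x‖ ≤ M * ‖h‖ * ‖k‖ := by
  have hd : Differentiable ℝ F := hF.differentiable (by norm_num)
  have h1 : ∀ z ∈ (univ : Set X), HasFDerivWithinAt (fun z => F (z + h) - F z)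
      (fderiv ℝ F (z + h) - fderiv ℝ F z) univ z := by
    intro z _
    refine HasFDerivAt.hasFDerivWithinAt (HasFDerivAt.sub ?_ (hd z).hasFDerivAt)
    simpa [Function.comp_def] using (hd (z + h)).hasFDerivAt.comp z ((hasFDerivAt_id z).add_const h)
  have := convex_univ.norm_image_sub_le_of_norm_hasFDerivWithin_le h1
    (C := M * ‖h‖) (fun z _ => by simpa using hM (z + h) z) (mem_univ x) (mem_univ (x + k))
  rw [add_sub_cancel_left] at this
  refine le_trans (le_of_eq ?_) this
  congr 1
  rw [add_right_comm x k h]; abel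

section Mild

variable {X : Type*} [NormedAddCommGroup X] [NormedSpace ℝ X]

/-- Right-hand sides: measurable in time, Lipschitz, with bounded second differences. -/
def AuxGood (T L : ℝ) (F : ℝ → X → X) : Prop :=
  (∀ x, AEStronglyMeasurable (fun t => F t x) (volume.restrict (Icc (0:ℝ) T))) ∧
  ∀ᵐ t ∂(volume.restrict (Icc (0:ℝ) T)),
    (∀ x y, ‖F t x - F t y‖ ≤ L * ‖x - y‖) ∧ ‖F t 0‖ ≤ L ∧
    ∀ x h k, ‖F t (x + h + k) - F t (x + h) - F t (x + k) + F t x‖ ≤ L * ‖h‖ * ‖k‖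

/-- `E` is given by the variation of constants formula with source `q`. -/
def AuxMild (S : ℝ → X →L[ℝ] X) (q : ℝ → X) (s b : ℝ) (e : X) (E : ℝ → X) : Prop :=
  ContinuousOn E (Icc s b) ∧ ∀ t ∈ Icc s b,
    IntervalIntegrable (fun τ => S (t - τ) (q τ)) volume s t ∧
    E t = S (t - s) e + ∫ τ in s..t, S (t - τ) (q τ)

theorem AuxMild.mono {S : ℝ → X →L[ℝ] X} {q : ℝ → X} {s b b' : ℝ} {e : X} {E : ℝ → X}
    (h : AuxMild S q s b e E) (hb : b' ≤ b) : AuxMild S q s b' e E :=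
  ⟨h.1.mono (Icc_subset_Icc_right hb), fun t ht => h.2 t ⟨ht.1, ht.2.trans hb⟩⟩

theorem AuxMild.sub {S : ℝ → X →L[ℝ] X} {q₁ q₂ : ℝ → X} {s b : ℝ} {e₁ e₂ : X} {E₁ E₂ : ℝ → X}
    (h₁ : AuxMild S q₁ s b e₁ E₁) (h₂ : AuxMild S q₂ s b e₂ E₂) :
    AuxMild S (fun τ => q₁ τ - q₂ τ) s b (e₁ - e₂) (fun τ => E₁ τ - E₂ τ) := by
  refine ⟨h₁.1.sub h₂.1, fun t ht => ?_⟩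
  obtain ⟨i₁, f₁⟩ := h₁.2 t ht
  obtain ⟨i₂, f₂⟩ := h₂.2 t ht
  constructor
  · simpa only [map_sub] using i₁.sub i₂
  · simp only [map_sub]
    rw [intervalIntegral.integral_sub i₁ i₂, f₁, f₂]
    abel

theorem AuxMild.gronwall {S : ℝ → X →L[ℝ] X} {q : ℝ → X} {s b T C L β : ℝ} {e : X} {E : ℝ → X}
    (hC : 0 ≤ C) (hS : ∀ σ ∈ Icc 0 T, ‖S σ‖ ≤ C) (hs : 0 ≤ s) (hsb : s ≤ b) (hbT : b ≤ T)
    (hL : 0 ≤ L) (hβ : 0 ≤ β) (h : AuxMild S q s b e E)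
    (hq : ∀ᵐ τ ∂(volume.restrict (Icc s b)), ‖q τ‖ ≤ L * ‖E τ‖ + β) :
    ‖E b‖ ≤ C * (‖e‖ + β * (b - s)) * Real.exp (C * L * (b - s)) := by
  refine aux_gronwall (w := fun r => ‖E r‖) hsb
    (mul_nonneg hC (add_nonneg (norm_nonneg _) (mul_nonneg hβ (sub_nonneg.2 hsb))))
    (mul_nonneg hC hL) h.1.norm (fun r _ => norm_nonneg _) fun r hr => ?_
  have hEi : IntervalIntegrable (fun τ => ‖E τ‖) volume s r := by
    refine ContinuousOn.intervalIntegrable ?_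
    rw [uIcc_of_le hr.1]
    exact (h.1.mono (Icc_subset_Icc_right hr.2)).norm
  have hi : ‖∫ τ in s..r, S (r - τ) (q τ)‖ ≤ ∫ τ in s..r, (C * L * ‖E τ‖ + C * β) := by
    refine intervalIntegral.norm_integral_le_of_norm_le hr.1 ?_
      ((hEi.const_mul _).add intervalIntegrable_const)
    rw [ae_restrict_iff' measurableSet_Icc] at hq
    filter_upwards [hq] with τ hτ hτm
    have h1 := hτ ⟨hτm.1.le, hτm.2.trans hr.2⟩
    have h2 := hS (r - τ) ⟨by linarith [hτm.2], by linarith [hτm.1, hr.2]⟩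
    calc ‖S (r - τ) (q τ)‖ ≤ ‖S (r - τ)‖ * ‖q τ‖ := (S (r - τ)).le_opNorm _
      _ ≤ C * (L * ‖E τ‖ + β) := by gcongr
      _ = _ := by ring
  rw [intervalIntegral.integral_add (hEi.const_mul _) intervalIntegrable_const,
    intervalIntegral.integral_const_mul, intervalIntegral.integral_const, smul_eq_mul] at hi
  rw [(h.2 r hr).2]
  have h3 : ‖S (r - s) e‖ ≤ C * ‖e‖ :=
    ((S (r - s)).le_opNorm _).trans (by
      gcongr; exact hS _ ⟨by linarith [hr.1], by linarith [hr.2]⟩)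
  have h4 : (r - s) * (C * β) ≤ C * (β * (b - s)) := by
    have : (r - s) * (C * β) ≤ (b - s) * (C * β) := by
      have := hr.2
      gcongr
    linarith
  calc _ ≤ ‖S (r - s) e‖ + ‖∫ τ in s..r, S (r - τ) (q τ)‖ := norm_add_le _ _
    _ ≤ _ := by linarith

theorem AuxMild.shift {S : ℝ → X →L[ℝ] X} [CompleteSpace X] {q : ℝ → X} {s b r : ℝ} {e : X}
    {E : ℝ → X}
    (hSadd : ∀ a b : ℝ, 0 ≤ a → 0 ≤ b → S (a + b) = (S a).comp (S b))
    (h : AuxMild S q s b e E) (hr : r ∈ Icc s b) : AuxMild S q r b (E r) E := by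
  refine ⟨h.1.mono (Icc_subset_Icc_left hr.1), fun t ht => ?_⟩
  obtain ⟨i, f⟩ := h.2 t ⟨hr.1.trans ht.1, ht.2⟩
  obtain ⟨i', f'⟩ := h.2 r hr
  have hst : s ≤ t := hr.1.trans ht.1
  have i1 : IntervalIntegrable (fun τ => S (t - τ) (q τ)) volume s r :=
    i.mono_set (by rw [uIcc_of_le hr.1, uIcc_of_le hst]; exact Icc_subset_Icc_right ht.1)
  have i2 : IntervalIntegrable (fun τ => S (t - τ) (q τ)) volume r t :=
    i.mono_set (by rw [uIcc_of_le ht.1, uIcc_of_le hst]; exact Icc_subset_Icc_left hr.1)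
  refine ⟨i2, ?_⟩
  rw [f, f', map_add, ← (S (t - r)).intervalIntegral_comp_comm i',
    ← intervalIntegral.integral_add_adjacent_intervals i1 i2, add_assoc]
  have e1 : S (t - s) e = S (t - r) (S (r - s) e) := by
    have := hSadd (t - r) (r - s) (sub_nonneg.2 ht.1) (sub_nonneg.2 hr.1)
    rw [sub_add_sub_cancel] at this
    rw [this]; rfl
  rw [e1]
  congr 2
  refine intervalIntegral.integral_congr fun τ hτ => ?_
  rw [uIcc_of_le hr.1] at hτ
  have := hSadd (t - r) (r - τ) (sub_nonneg.2 ht.1) (sub_nonneg.2 hτ.2)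
  rw [sub_add_sub_cancel] at this
  simp only [this]; rfl

theorem aux_int {S : ℝ → X →L[ℝ] X} {q : ℝ → X} {s r T C B : ℝ} (hC : 0 ≤ C)
    (hScont : ∀ x : X, ContinuousOn (fun σ => S σ x) (Set.Ici (0 : ℝ)))
    (hS : ∀ σ ∈ Icc 0 T, ‖S σ‖ ≤ C) (hs : 0 ≤ s) (hsr : s ≤ r) (hrT : r ≤ T)
    (hq : AEStronglyMeasurable q (volume.restrict (Icc s r)))
    (hB : ∀ᵐ τ ∂(volume.restrict (Icc s r)), ‖q τ‖ ≤ B) :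
    IntervalIntegrable (fun τ => S (r - τ) (q τ)) volume s r := by
  rw [intervalIntegrable_iff_integrableOn_Icc_of_le hsr]
  refine Integrable.of_bound (C := C * B) ?_ ?_
  · refine aux_carath (fun τ x => S (r - τ) x) (fun x => ?_)
      (Eventually.of_forall fun τ => (S (r - τ)).continuous) hq
    refine ContinuousOn.aestronglyMeasurable ?_ measurableSet_Icc
    exact (hScont x).comp (by fun_prop) (fun τ hτ => sub_nonneg.2 hτ.2)
  · filter_upwards [hB, ae_restrict_mem measurableSet_Icc] with τ h1 hτ
    have h2 := hS (r - τ) ⟨by linarith [hτ.2], by linarith [hτ.1]⟩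
    exact ((S (r - τ)).le_opNorm _).trans (by gcongr)

set_option linter.unusedSectionVars false

theorem AuxGood.ae_mono {T L s b : ℝ} {F : ℝ → X → X} (hF : AuxGood T L F)
    (hs : 0 ≤ s) (hbT : b ≤ T) : ∀ᵐ t ∂(volume.restrict (Icc s b)),
    (∀ x y, ‖F t x - F t y‖ ≤ L * ‖x - y‖) ∧ ‖F t 0‖ ≤ L ∧
    ∀ x h k, ‖F t (x + h + k) - F t (x + h) - F t (x + k) + F t x‖ ≤ L * ‖h‖ * ‖k‖ :=
  ae_restrict_of_ae_restrict_of_subset (Icc_subset_Icc hs hbT) hF.2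

theorem aux_growth {L : ℝ} {F : X → X} (h1 : ∀ x y, ‖F x - F y‖ ≤ L * ‖x - y‖) (h2 : ‖F 0‖ ≤ L)
    (x : X) : ‖F x‖ ≤ L * ‖x‖ + L := by
  have h3 := h1 x 0
  have h4 : ‖F x‖ ≤ ‖F x - F 0‖ + ‖F 0‖ := by simpa using norm_add_le (F x - F 0) (F 0)
  rw [sub_zero] at h3
  linarith

theorem AuxGood.aesm {T L s b : ℝ} {F : ℝ → X → X} {φ : ℝ → X}
    (hF : AuxGood T L F) (hL : 0 ≤ L) (hs : 0 ≤ s) (hbT : b ≤ T)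
    (h : ContinuousOn φ (Icc s b)) :
    AEStronglyMeasurable (fun τ => F τ (φ τ)) (volume.restrict (Icc s b)) := by
  refine aux_carath F (fun x => (hF.1 x).mono_measure
      (Measure.restrict_mono (Icc_subset_Icc hs hbT) le_rfl)) ?_
      (h.aestronglyMeasurable measurableSet_Icc)
  filter_upwards [hF.ae_mono hs hbT] with τ hτ
  refine (LipschitzWith.of_dist_le_mul (K := Real.toNNReal L) fun x y => ?_).continuous
  rw [dist_eq_norm, dist_eq_norm, Real.coe_toNNReal L hL]
  exact hτ.1 x y

theorem AuxGood.bound {T L s b B : ℝ} {F : ℝ → X → X} {φ : ℝ → X}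
    (hF : AuxGood T L F) (hL : 0 ≤ L) (hs : 0 ≤ s) (hbT : b ≤ T)
    (hB : ∀ τ ∈ Icc s b, ‖φ τ‖ ≤ B) :
    ∀ᵐ τ ∂(volume.restrict (Icc s b)), ‖F τ (φ τ)‖ ≤ L * B + L := by
  filter_upwards [hF.ae_mono hs hbT, ae_restrict_mem measurableSet_Icc] with τ hτ hτm
  refine (aux_growth hτ.1 hτ.2.1 _).trans ?_
  have := hB τ hτm
  gcongr

theorem AuxGood.mild {S : ℝ → X →L[ℝ] X} {T L C s b : ℝ} {F : ℝ → X → X} {φ : ℝ → X} {e : X}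
    (hF : AuxGood T L F) (hL : 0 ≤ L) (hC : 0 ≤ C)
    (hScont : ∀ x : X, ContinuousOn (fun σ => S σ x) (Set.Ici (0 : ℝ)))
    (hS : ∀ σ ∈ Icc 0 T, ‖S σ‖ ≤ C) (hs : 0 ≤ s) (hbT : b ≤ T)
    (h : IsMildSol b S F s e φ) : AuxMild S (fun τ => F τ (φ τ)) s b e φ := by
  refine ⟨h.1, fun t ht => ⟨?_, h.2 t ht⟩⟩
  obtain ⟨B, hB⟩ := isCompact_Icc.exists_bound_of_continuousOn h.1
  have htT : t ≤ T := ht.2.trans hbT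
  exact aux_int (B := L * B + L) hC hScont hS hs ht.1 htT
    (hF.aesm hL hs htT (h.1.mono (Icc_subset_Icc_right ht.2)))
    (hF.bound hL hs htT fun τ hτ => hB τ ⟨hτ.1, hτ.2.trans ht.2⟩)

theorem AuxGood.lip {S : ℝ → X →L[ℝ] X} {T L C s b : ℝ} {F : ℝ → X → X} {φ ψ : ℝ → X} {e e' : X}
    (hF : AuxGood T L F) (hL : 0 ≤ L) (hC : 0 ≤ C)
    (hS : ∀ σ ∈ Icc 0 T, ‖S σ‖ ≤ C) (hs : 0 ≤ s) (hsb : s ≤ b) (hbT : b ≤ T)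
    (h : AuxMild S (fun τ => F τ (φ τ)) s b e φ)
    (h' : AuxMild S (fun τ => F τ (ψ τ)) s b e' ψ) :
    ‖φ b - ψ b‖ ≤ C * Real.exp (C * L * T) * ‖e - e'‖ := by
  have := (h.sub h').gronwall hC hS hs hsb hbT hL le_rfl (by
    filter_upwards [hF.ae_mono hs hbT] with τ hτ
    simpa using hτ.1 (φ τ) (ψ τ))
  simp only [zero_mul, add_zero] at this
  refine this.trans ?_
  have h2 : Real.exp (C * L * (b - s)) ≤ Real.exp (C * L * T) := by
    have : b - s ≤ T := by linarith
    gcongr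
  calc _ ≤ C * ‖e - e'‖ * Real.exp (C * L * T) := by gcongr
    _ = _ := by ring

theorem AuxGood.differentiable [CompleteSpace X] {S : ℝ → X →L[ℝ] X} {T L C s b : ℝ}
    {F : ℝ → X → X}
    {Ψ : ℝ → X → X} (hF : AuxGood T L F) (hL : 0 ≤ L) (hC : 0 ≤ C)
    (hS : ∀ σ ∈ Icc 0 T, ‖S σ‖ ≤ C) (hs : 0 ≤ s) (hsb : s ≤ b) (hbT : b ≤ T)
    (h : ∀ x, AuxMild S (fun τ => F τ (Ψ τ x)) s b x (fun τ => Ψ τ x)) (x : X) :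
    DifferentiableAt ℝ (Ψ b) x := by
  set K := C * Real.exp (C * L * T) with hK
  have hK0 : 0 ≤ K := by positivity
  have hlip : ∀ τ ∈ Icc s b, ∀ x y, ‖Ψ τ x - Ψ τ y‖ ≤ K * ‖x - y‖ := fun τ hτ x y =>
    hF.lip hL hC hS hs hτ.1 (hτ.2.trans hbT) ((h x).mono hτ.2) ((h y).mono hτ.2)
  refine aux_diff (Ψ b) (L := K) (C := C * (L * K * K * (b - s)) * Real.exp (C * L * (b - s)))
    (hlip b ⟨hsb, le_rfl⟩) ?_ x
  intro x d k
  have hm := ((h (x + d + k)).sub (h (x + d))).sub ((h (x + k)).sub (h x))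
  have := hm.gronwall hC hS hs hsb hbT hL (β := L * K * K * ‖d‖ * ‖k‖) (by positivity) (by
    filter_upwards [hF.ae_mono hs hbT, ae_restrict_mem measurableSet_Icc] with τ hτ hτm
    set A := Ψ τ (x + d + k)
    set B := Ψ τ (x + d) with hB
    set D := Ψ τ (x + k) with hD
    set Z := Ψ τ x with hZ
    have hBZ : ‖B - Z‖ ≤ K * ‖d‖ := by simpa using hlip τ hτm (x + d) x
    have hDZ : ‖D - Z‖ ≤ K * ‖k‖ := by simpa using hlip τ hτm (x + k) x
    have h1 := hτ.1 A (Z + (B - Z) + (D - Z))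
    have h2 := hτ.2.2 Z (B - Z) (D - Z)
    have e1 : A - (Z + (B - Z) + (D - Z)) = A - B - (D - Z) := by abel
    have e2 : Z + (B - Z) = B := by abel
    have e3 : Z + (D - Z) = D := by abel
    rw [e1] at h1
    rw [e3, e2] at h2
    rw [e2] at h1
    have e4 : F τ A - F τ B - (F τ D - F τ Z) = (F τ A - F τ (B + (D - Z))) +
      (F τ (B + (D - Z)) - F τ B - F τ D + F τ Z) := by abel
    rw [e4]
    refine (norm_add_le _ _).trans (add_le_add h1 (h2.trans ?_))
    calc L * ‖B - Z‖ * ‖D - Z‖ ≤ L * (K * ‖d‖) * (K * ‖k‖) := by gcongr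
      _ = _ := by ring)
  have e0 : x + d + k - (x + d) - (x + k - x) = 0 := by abel
  rw [e0, norm_zero, zero_add] at this
  calc _ = ‖Ψ b (x + d + k) - Ψ b (x + d) - (Ψ b (x + k) - Ψ b x)‖ := by congr 1; abel
    _ ≤ _ := this
    _ = _ := by ring

theorem aux_lebesgue_left {w : ℝ → X} {T : ℝ}
    (hw : IntegrableOn w (Icc 0 T)) :
    ∀ᵐ t, t ∈ Ioc 0 T →
      Tendsto (fun s => (t - s)⁻¹ * ∫ τ in s..t, ‖w τ - w t‖) (nhdsWithin t (Iio t)) (nhds 0) := by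
  have hw' : LocallyIntegrable ((Icc 0 T).indicator w) :=
    ((integrable_indicator_iff measurableSet_Icc).2 hw).locallyIntegrable
  filter_upwards [(IsUnifLocDoublingMeasure.vitaliFamily (volume : Measure ℝ)
    1).ae_tendsto_average_norm_sub hw'] with t ht htm
  refine (ht.comp (Real.tendsto_Icc_vitaliFamily_left t)).congr' ?_
  filter_upwards [Ioo_mem_nhdsLT htm.1] with s hs
  have hst : s ≤ t := hs.2.le
  simp only [Function.comp]
  rw [setAverage_eq, smul_eq_mul, measureReal_def, Real.volume_Icc,
    ENNReal.toReal_ofReal (sub_nonneg.2 hst), integral_Icc_eq_integral_Ioc,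
    ← intervalIntegral.integral_of_le hst]
  congr 1
  refine intervalIntegral.integral_congr fun τ hτ => ?_
  rw [uIcc_of_le hst] at hτ
  rw [indicator_of_mem (show τ ∈ Icc 0 T from ⟨hs.1.le.trans hτ.1, hτ.2.trans htm.2⟩),
    indicator_of_mem (show t ∈ Icc 0 T from ⟨htm.1.le, htm.2⟩)]

/-- The key local expansion of the variation of constants formula. -/
theorem aux_left_deriv [CompleteSpace X] {S : ℝ → X →L[ℝ] X} {T C B t : ℝ} {w : ℝ → X}
    {q : ℝ → ℝ → X} {y : ℝ → X} (hC : 0 ≤ C) (hB : 0 ≤ B)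
    (hS0 : S 0 = ContinuousLinearMap.id ℝ X)
    (hScont : ∀ x : X, ContinuousOn (fun σ => S σ x) (Set.Ici (0 : ℝ)))
    (hS : ∀ σ ∈ Icc 0 T, ‖S σ‖ ≤ C) (ht : t ∈ Ioc 0 T)
    (hw : IntegrableOn w (Icc 0 T))
    (hleb : Tendsto (fun s => (t - s)⁻¹ * ∫ τ in s..t, ‖w τ - w t‖)
      (nhdsWithin t (Iio t)) (nhds 0))
    (hy : ∀ s ∈ Ioo 0 t, IntervalIntegrable (fun τ => S (t - τ) (q s τ)) volume s t ∧
      y t - y s = ∫ τ in s..t, S (t - τ) (q s τ))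
    (hq : ∀ s ∈ Ioo 0 t, ∀ᵐ τ ∂(volume.restrict (Icc s t)), ‖q s τ - w τ‖ ≤ B * (t - s)) :
    HasDerivWithinAt y (w t) (Iio t) t := by
  rw [hasDerivWithinAt_iff_isLittleO, Asymptotics.isLittleO_iff]
  intro c hc
  have hcont : ∀ᶠ σ in nhdsWithin (0:ℝ) (Ici 0), ‖S σ (w t) - w t‖ < c / 3 := by
    have := (hScont (w t)) 0 self_mem_Ici
    have h2 := (this.tendsto.sub_const (w t)).norm
    simp only [hS0, ContinuousLinearMap.id_apply, sub_self, norm_zero] at h2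
    exact h2.eventually_lt_const (by positivity)
  obtain ⟨δ, hδ, hδS⟩ := (mem_nhdsGE_iff_exists_Ico_subset).1 hcont
  have hδ0 : (0:ℝ) < δ := hδ
  have hc1 : 0 < c / (3 * (C + 1)) := by positivity
  have hc2 : 0 < c / (3 * (C * B + 1)) := by positivity
  have hev : ∀ᶠ s in nhdsWithin t (Iio t), t - δ < s :=
    mem_nhdsWithin_of_mem_nhds (Ioi_mem_nhds (by linarith))
  have hev2 : ∀ᶠ s in nhdsWithin t (Iio t), t - c / (3 * (C * B + 1)) < s :=
    mem_nhdsWithin_of_mem_nhds (Ioi_mem_nhds (by linarith))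
  filter_upwards [Ioo_mem_nhdsLT ht.1, hev, hev2, hleb.eventually_lt_const hc1] with s hs h1 h2 h3
  obtain ⟨hi, hys⟩ := hy s hs
  have hst : s ≤ t := hs.2.le
  have hpos : 0 < t - s := sub_pos.2 hs.2
  have e1 : y s - y t - (s - t) • w t = -(∫ τ in s..t, (S (t - τ) (q s τ) - w t)) := by
    rw [intervalIntegral.integral_sub hi intervalIntegrable_const, ← hys,
      intervalIntegral.integral_const]
    module
  have hwi : IntervalIntegrable (fun τ => ‖w τ - w t‖) volume s t := by
    refine (IntervalIntegrable.sub ?_ intervalIntegrable_const).norm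
    rw [intervalIntegrable_iff_integrableOn_Icc_of_le hst]
    exact hw.mono_set (Icc_subset_Icc hs.1.le ht.2)
  have hb : ‖∫ τ in s..t, (S (t - τ) (q s τ) - w t)‖ ≤
      ∫ τ in s..t, (C * ‖w τ - w t‖ + (C * (B * (t - s)) + c / 3)) := by
    refine intervalIntegral.norm_integral_le_of_norm_le hst ?_
      ((hwi.const_mul _).add intervalIntegrable_const)
    have hq' := hq s hs
    rw [ae_restrict_iff' measurableSet_Icc] at hq'
    filter_upwards [hq'] with τ hτ hτm
    have g1 := hτ ⟨hτm.1.le, hτm.2⟩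
    have g2 := hS (t - τ) ⟨by linarith [hτm.2], by linarith [hτm.1, ht.2, hs.1]⟩
    have g3 : ‖S (t - τ) (w t) - w t‖ < c / 3 :=
      hδS ⟨by linarith [hτm.2], by linarith [hτm.1]⟩
    have e2 : S (t - τ) (q s τ) - w t = S (t - τ) (q s τ - w τ) + S (t - τ) (w τ - w t) +
        (S (t - τ) (w t) - w t) := by
      simp only [map_sub]; abel
    rw [e2]
    have g4 : ‖S (t - τ) (q s τ - w τ)‖ ≤ C * (B * (t - s)) :=
      ((S (t - τ)).le_opNorm _).trans (by gcongr)
    have g5 : ‖S (t - τ) (w τ - w t)‖ ≤ C * ‖w τ - w t‖ :=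
      ((S (t - τ)).le_opNorm _).trans (by gcongr)
    refine (norm_add₃_le).trans ?_
    linarith
  rw [intervalIntegral.integral_add (hwi.const_mul _) intervalIntegrable_const,
    intervalIntegral.integral_const_mul, intervalIntegral.integral_const, smul_eq_mul] at hb
  rw [e1, norm_neg, Real.norm_eq_abs, abs_sub_comm, abs_of_pos hpos]
  refine hb.trans ?_
  have k1 : ∫ τ in s..t, ‖w τ - w t‖ ≤ c / (3 * (C + 1)) * (t - s) := by
    rw [inv_mul_lt_iff₀ hpos] at h3
    linarith
  have k2 : C * (∫ τ in s..t, ‖w τ - w t‖) ≤ c / 3 * (t - s) := by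
    calc _ ≤ C * (c / (3 * (C + 1)) * (t - s)) := by gcongr
      _ ≤ (C + 1) * (c / (3 * (C + 1)) * (t - s)) := by gcongr; linarith
      _ = _ := by field_simp
  have k3 : C * (B * (t - s)) ≤ c / 3 := by
    calc C * (B * (t - s)) = (C * B) * (t - s) := by ring
      _ ≤ (C * B + 1) * (c / (3 * (C * B + 1))) := by
        apply mul_le_mul <;> first | positivity | linarith
      _ = _ := by field_simp
  have k4 : (t - s) * (C * (B * (t - s)) + c / 3) ≤ (t - s) * (c / 3 + c / 3) := by gcongr
  linarith

theorem aux_core [CompleteSpace X] {S : ℝ → X →L[ℝ] X} {T L : ℝ} (hT : 0 < T) (hL : 0 ≤ L)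
    (hS0 : S 0 = ContinuousLinearMap.id ℝ X)
    (hSadd : ∀ a b : ℝ, 0 ≤ a → 0 ≤ b → S (a + b) = (S a).comp (S b))
    (hScont : ∀ x : X, ContinuousOn (fun σ => S σ x) (Set.Ici (0 : ℝ)))
    {F Fb : ℝ → X → X} (hF : AuxGood T L F) (hFb : AuxGood T L Fb)
    {Φ : ℝ → ℝ → X → X}
    (hΦ : ∀ s ∈ Set.Icc (0:ℝ) T, ∀ x : X, IsMildSol T S Fb s x (fun t => Φ s t x))
    {ℓ : X → ℝ} (hℓ : Differentiable ℝ ℓ)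
    (hℓLip : ∀ B : Set X, Bornology.IsBounded B →
      ∃ K : ℝ, ∀ x ∈ B, ∀ y ∈ B, |ℓ x - ℓ y| ≤ K * ‖x - y‖)
    {x₀ : X} {xu : ℝ → X} (hxu : IsMildSol T S F 0 x₀ xu) :
    IntervalIntegrable (fun t => fderiv ℝ (fun y => ℓ (Φ t T y)) (xu t)
      (F t (xu t) - Fb t (xu t))) volume 0 T ∧
    ∫ t in (0:ℝ)..T, fderiv ℝ (fun y => ℓ (Φ t T y)) (xu t) (F t (xu t) - Fb t (xu t)) =
      ℓ (xu T) - ℓ (Φ 0 T x₀) := by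
  obtain ⟨C, hC1, hS⟩ := aux_semigroup_bound (T := T) S hScont
  have hC : 0 ≤ C := zero_le_one.trans hC1
  have mx := hF.mild hL hC hScont hS le_rfl le_rfl hxu
  have mΦ : ∀ s ∈ Icc (0:ℝ) T, ∀ x, AuxMild S (fun τ => Fb τ (Φ s τ x)) s T x
      (fun t => Φ s t x) := fun s hs x =>
    hFb.mild hL hC hScont hS hs.1 le_rfl (hΦ s hs x)
  -- initial values
  have hΦ0 : ∀ s ∈ Icc (0:ℝ) T, ∀ x, Φ s s x = x := fun s hs x => by
    simpa [hS0] using (hΦ s hs x).2 s ⟨le_rfl, hs.2⟩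
  have hx0 : xu 0 = x₀ := by simpa [hS0] using hxu.2 0 ⟨le_rfl, hT.le⟩
  -- bounds
  obtain ⟨B₀, hB₀⟩ := isCompact_Icc.exists_bound_of_continuousOn hxu.1
  set B := max B₀ 0 with hBdef
  have hB0 : 0 ≤ B := le_max_right _ _
  have hB : ∀ τ ∈ Icc 0 T, ‖xu τ‖ ≤ B := fun τ hτ => (hB₀ τ hτ).trans (le_max_left _ _)
  set w : ℝ → X := fun τ => F τ (xu τ) - Fb τ (xu τ) with hw
  set W := (L * B + L) + (L * B + L) with hWdef
  have hW0 : 0 ≤ W := by positivity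
  have hwW : ∀ᵐ τ ∂(volume.restrict (Icc 0 T)), ‖w τ‖ ≤ W := by
    filter_upwards [hF.bound hL le_rfl le_rfl hB, hFb.bound hL le_rfl le_rfl hB] with τ h1 h2
    exact (norm_sub_le _ _).trans (add_le_add h1 h2)
  have hwi : IntegrableOn w (Icc 0 T) :=
    Integrable.of_bound ((hF.aesm hL le_rfl le_rfl hxu.1).sub
      (hFb.aesm hL le_rfl le_rfl hxu.1)) W hwW
  -- flow property
  have hflow : ∀ s ∈ Icc (0:ℝ) T, ∀ t ∈ Icc s T, ∀ z, Φ s T z = Φ t T (Φ s t z) := by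
    intro s hs t ht z
    have ht' : t ∈ Icc 0 T := ⟨hs.1.trans ht.1, ht.2⟩
    have := hFb.lip hL hC hS ht'.1 ht.2 le_rfl ((mΦ s hs z).shift hSadd ht) (mΦ t ht' (Φ s t z))
    rw [sub_self, norm_zero, mul_zero] at this
    exact sub_eq_zero.1 (norm_le_zero_iff.1 this)
  -- the difference of trajectories
  have mD : ∀ s ∈ Icc (0:ℝ) T, AuxMild S (fun τ => F τ (xu τ) - Fb τ (Φ s τ (xu s))) s T
      (xu s - xu s) (fun τ => xu τ - Φ s τ (xu s)) := fun s hs =>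
    (mx.shift hSadd hs).sub (mΦ s hs (xu s))
  set K := C * Real.exp (C * L * T) with hK
  have hK0 : 0 ≤ K := by positivity
  have hD : ∀ s ∈ Icc (0:ℝ) T, ∀ t ∈ Icc s T, ‖xu t - Φ s t (xu s)‖ ≤ K * W * (t - s) := by
    intro s hs t ht
    have := ((mD s hs).mono ht.2).gronwall hC hS hs.1 ht.1 ht.2 hL hW0 (by
      filter_upwards [hFb.ae_mono hs.1 ht.2,
        ae_restrict_of_ae_restrict_of_subset (Icc_subset_Icc hs.1 ht.2) hwW] with τ h1 h2
      have h3 := h1.1 (xu τ) (Φ s τ (xu s))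
      have e : F τ (xu τ) - Fb τ (Φ s τ (xu s)) =
        (Fb τ (xu τ) - Fb τ (Φ s τ (xu s))) + w τ := by simp only [hw]; abel
      rw [e]
      exact (norm_add_le _ _).trans (add_le_add h3 h2))
    rw [sub_self, norm_zero, zero_add] at this
    refine this.trans ?_
    have h0 : 0 ≤ t - s := sub_nonneg.2 ht.1
    have h1 : t - s ≤ T := by linarith [hs.1, ht.2]
    calc C * (W * (t - s)) * Real.exp (C * L * (t - s))
        ≤ C * (W * (t - s)) * Real.exp (C * L * T) := by gcongr
      _ = _ := by rw [hK]; ring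
  set g : ℝ → ℝ := fun t => ℓ (Φ t T (xu t)) with hg
  -- Lipschitz continuity of `g`
  have hbd : ∀ t ∈ Icc (0:ℝ) T, ‖Φ t T (xu t)‖ ≤ C * (B + L * T) * Real.exp (C * L * T) := by
    intro t ht
    have := (mΦ t ht (xu t)).gronwall hC hS ht.1 ht.2 le_rfl hL hL (by
      filter_upwards [hFb.ae_mono ht.1 le_rfl] with τ h1
      exact aux_growth h1.1 h1.2.1 _)
    refine this.trans ?_
    have h0 : 0 ≤ T - t := sub_nonneg.2 ht.2
    have h1 : T - t ≤ T := by linarith [ht.1]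
    have h2 := hB t ht
    gcongr
  obtain ⟨Kl, hKl⟩ := hℓLip (Metric.closedBall 0 (C * (B + L * T) * Real.exp (C * L * T)))
    Metric.isBounded_closedBall
  have hgl : ∀ s ∈ Icc (0:ℝ) T, ∀ t ∈ Icc s T, |g t - g s| ≤ |Kl| * (K * (K * W)) * (t - s) := by
    intro s hs t ht
    have ht' : t ∈ Icc 0 T := ⟨hs.1.trans ht.1, ht.2⟩
    have h1 := hKl (Φ t T (xu t)) (by simpa using hbd t ht') (Φ s T (xu s))
      (by simpa using hbd s hs)
    have h2 : ‖Φ t T (xu t) - Φ s T (xu s)‖ ≤ K * ‖xu t - Φ s t (xu s)‖ := by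
      rw [hflow s hs t ht]
      exact hFb.lip hL hC hS ht'.1 ht.2 le_rfl (mΦ t ht' _) (mΦ t ht' _)
    calc |g t - g s| ≤ Kl * ‖Φ t T (xu t) - Φ s T (xu s)‖ := h1
      _ ≤ |Kl| * (K * (K * W * (t - s))) := by
        gcongr
        · exact le_abs_self _
        · exact h2.trans (by gcongr; exact hD s hs t ht)
      _ = _ := by ring
  have hlip : LipschitzOnWith (Real.toNNReal (|Kl| * (K * (K * W)))) g (uIcc 0 T) := by
    rw [uIcc_of_le hT.le]
    refine LipschitzOnWith.of_dist_le_mul fun s hs t ht => ?_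
    rw [Real.coe_toNNReal _ (by positivity), Real.dist_eq, Real.dist_eq]
    rcases le_total s t with h | h
    · rw [abs_sub_comm, abs_sub_comm s t, abs_of_nonneg (sub_nonneg.2 h)]
      exact hgl s hs t ⟨h, ht.2⟩
    · rw [abs_of_nonneg (sub_nonneg.2 h)]
      exact hgl t ht s ⟨h, hs.2⟩
  have hac := hlip.absolutelyContinuousOnInterval
  -- the derivative
  have hder : ∀ᵐ t, t ∈ Ioc 0 T → deriv g t = fderiv ℝ (fun y => ℓ (Φ t T y)) (xu t) (w t) := by
    filter_upwards [aux_lebesgue_left hwi, hac.ae_differentiableAt] with t hleb hdiff ht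
    have ht' : t ∈ Icc 0 T := ⟨ht.1.le, ht.2⟩
    have hd := (hdiff (by rw [uIcc_of_le hT.le]; exact ht')).hasDerivAt
    have hy : HasDerivWithinAt (fun s => Φ s t (xu s)) (w t) (Iio t) t := by
      refine aux_left_deriv (q := fun s τ => F τ (xu τ) - Fb τ (Φ s τ (xu s)))
        (B := L * (K * W)) hC (by positivity) hS0 hScont hS ht hwi (hleb ht) ?_ ?_
      · intro s hs
        have hs' : s ∈ Icc 0 T := ⟨hs.1.le, hs.2.le.trans ht.2⟩
        have := (mD s hs').2 t ⟨hs.2.le, ht.2⟩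
        refine ⟨this.1, ?_⟩
        have h2 := this.2
        rw [sub_self, map_zero, zero_add] at h2
        rw [hΦ0 t ht']
        exact h2
      · intro s hs
        have hs' : s ∈ Icc 0 T := ⟨hs.1.le, hs.2.le.trans ht.2⟩
        filter_upwards [hFb.ae_mono hs.1.le ht.2, ae_restrict_mem measurableSet_Icc] with τ h1 h2
        have h3 := h1.1 (xu τ) (Φ s τ (xu s))
        have h4 := hD s hs' τ ⟨h2.1, h2.2.trans ht.2⟩
        have e : F τ (xu τ) - Fb τ (Φ s τ (xu s)) - w τ =
          Fb τ (xu τ) - Fb τ (Φ s τ (xu s)) := by simp only [hw]; abel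
        rw [e]
        refine h3.trans ?_
        have h5 : τ - s ≤ t - s := by linarith [h2.2]
        calc L * ‖xu τ - Φ s τ (xu s)‖ ≤ L * (K * W * (t - s)) := by
              gcongr; exact h4.trans (by gcongr)
          _ = _ := by ring
    have hPd : DifferentiableAt ℝ (fun y => ℓ (Φ t T y)) (Φ t t (xu t)) :=
      (hℓ _).comp _ (hFb.differentiable (Ψ := fun τ x => Φ t τ x) hL hC hS ht'.1 ht.2 le_rfl
        (mΦ t ht') _)
    have hcomp := hPd.hasFDerivAt.comp_hasDerivWithinAt t hy
    have hcomp2 : HasDerivWithinAt g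
        (fderiv ℝ (fun y => ℓ (Φ t T y)) (Φ t t (xu t)) (w t)) (Iio t) t := by
      refine hcomp.congr_of_eventuallyEq ?_ ?_
      · filter_upwards [Ioo_mem_nhdsLT ht.1] with s hs
        simp only [hg, Function.comp]
        rw [hflow s ⟨hs.1.le, hs.2.le.trans ht.2⟩ t ⟨hs.2.le, ht.2⟩]
      · simp only [hg, Function.comp]
        rw [hΦ0 t ht']
    rw [hΦ0 t ht'] at hcomp2
    exact (uniqueDiffWithinAt_Iio t).eq_deriv _ hd.hasDerivWithinAt hcomp2
  have hder' : ∀ᵐ t, t ∈ uIoc 0 T →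
      deriv g t = fderiv ℝ (fun y => ℓ (Φ t T y)) (xu t) (w t) := by
    rwa [uIoc_of_le hT.le]
  constructor
  · refine hac.intervalIntegrable_deriv.congr_ae ?_
    rw [Filter.EventuallyEq, ae_restrict_iff' measurableSet_uIoc]
    exact hder'
  · rw [← intervalIntegral.integral_congr_ae hder', hac.integral_deriv_eq_sub]
    simp only [hg]
    rw [hΦ0 T ⟨hT.le, le_rfl⟩, hx0]

theorem aux_good {m : ℕ} {T : ℝ}
    (f : ℝ → X → X) (G : ℝ → X → EuclideanSpace ℝ (Fin m) →L[ℝ] X)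
    {Mf MG M R : ℝ} (hMf : 0 ≤ Mf) (hMG : 0 ≤ MG) (hM : 0 ≤ M) (hR : 0 ≤ R)
    (hfmeas : ∀ x : X,
      AEStronglyMeasurable (fun t => f t x) (volume.restrict (Set.Icc (0:ℝ) T)))
    (hGmeas : ∀ x : X,
      AEStronglyMeasurable (fun t => G t x) (volume.restrict (Set.Icc (0:ℝ) T)))
    (hA : ∀ᵐ t ∂(volume.restrict (Set.Icc (0:ℝ) T)),
        (∀ x y : X, ‖f t x - f t y‖ ≤ Mf * ‖x - y‖) ∧
        (∀ x y : X, ‖G t x - G t y‖ ≤ MG * ‖x - y‖) ∧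
        ‖f t 0‖ ≤ Mf ∧ ‖G t 0‖ ≤ MG)
    (hAplus : ∀ᵐ t ∂(volume.restrict (Set.Icc (0:ℝ) T)),
        ContDiff ℝ 1 (f t) ∧ ContDiff ℝ 1 (G t) ∧
        (∀ x : X, ‖fderiv ℝ (f t) x‖ ≤ M) ∧
        (∀ x : X, ‖fderiv ℝ (G t) x‖ ≤ M) ∧
        (∀ x y : X, ‖fderiv ℝ (f t) x - fderiv ℝ (f t) y‖ ≤ M * ‖x - y‖) ∧
        (∀ x y : X, ‖fderiv ℝ (G t) x - fderiv ℝ (G t) y‖ ≤ M * ‖x - y‖))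
    (v : ℝ → EuclideanSpace ℝ (Fin m))
    (hv : AEStronglyMeasurable v (volume.restrict (Set.Icc (0:ℝ) T)))
    (hvR : ∀ᵐ t ∂(volume.restrict (Set.Icc (0:ℝ) T)), ‖v t‖ ≤ R) :
    AuxGood T (Mf + MG * R + (M + M * R)) (fun τ y => f τ y + G τ y (v τ)) := by
  constructor
  · intro x
    refine (hfmeas x).add (aux_carath (fun t z => G t x z)
      (fun z => (hGmeas x).apply_continuousLinearMap z)
      (Eventually.of_forall fun t => (G t x).continuous) hv)
  · filter_upwards [hA, hAplus, hvR] with t h1 h2 h3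
    obtain ⟨a1, a2, a3, a4⟩ := h1
    obtain ⟨b1, b2, -, -, b5, b6⟩ := h2
    have hp1 : 0 ≤ MG * R := by positivity
    have hp2 : 0 ≤ M * R := by positivity
    refine ⟨fun x y => ?_, ?_, fun x d k => ?_⟩
    · have e : f t x + G t x (v t) - (f t y + G t y (v t)) =
        (f t x - f t y) + (G t x - G t y) (v t) := by
        rw [_root_.sub_apply]; abel
      rw [e]
      calc _ ≤ ‖f t x - f t y‖ + ‖(G t x - G t y) (v t)‖ := norm_add_le _ _
        _ ≤ Mf * ‖x - y‖ + (MG * ‖x - y‖) * R := by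
          refine add_le_add (a1 x y) (((G t x - G t y).le_opNorm _).trans ?_)
          have := a2 x y
          gcongr
        _ = (Mf + MG * R) * ‖x - y‖ := by ring
        _ ≤ _ := mul_le_mul_of_nonneg_right (by linarith) (norm_nonneg _)
    · calc _ ≤ ‖f t 0‖ + ‖G t 0 (v t)‖ := norm_add_le _ _
        _ ≤ Mf + MG * R := by
          refine add_le_add a3 (((G t 0).le_opNorm _).trans ?_)
          gcongr
        _ ≤ _ := by linarith
    · have s1 := aux_second_diff (f t) b1 b5 x d k
      have s2 := aux_second_diff (G t) b2 b6 x d k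
      have e : f t (x + d + k) + G t (x + d + k) (v t) - (f t (x + d) + G t (x + d) (v t)) -
          (f t (x + k) + G t (x + k) (v t)) + (f t x + G t x (v t)) =
          (f t (x + d + k) - f t (x + d) - f t (x + k) + f t x) +
          (G t (x + d + k) - G t (x + d) - G t (x + k) + G t x) (v t) := by
        simp only [_root_.sub_apply, _root_.add_apply]; abel
      rw [e]
      calc _ ≤ _ := norm_add_le _ _
        _ ≤ M * ‖d‖ * ‖k‖ + (M * ‖d‖ * ‖k‖) * R := by
          refine add_le_add s1 ((ContinuousLinearMap.le_opNorm _ _).trans ?_)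
          gcongr
        _ = (M + M * R) * ‖d‖ * ‖k‖ := by ring
        _ ≤ _ := mul_le_mul_of_nonneg_right
          (mul_le_mul_of_nonneg_right (by linarith) (norm_nonneg _)) (norm_nonneg _)

end Mild

/-- the exact cost-increment formula
`𝓘[u] − 𝓘[ū] = ∫_I (H̄_t(x^u_t, u(t)) − H̄_t(x^u_t, ū(t))) dt`, where
`H̄_t(x, v) = (α/2)|v|² + vᵀ G_t(x)' Dp̄_t(x) = (α/2)‖v‖² + Dp̄_t(x)[G_t(x) v]`. -/
theorem exact_cost_increment_formula
    {X : Type*} [NormedAddCommGroup X] [NormedSpace ℝ X] [CompleteSpace X]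
    {m : ℕ} {T : ℝ} (hT : 0 < T)
    (S : ℝ → X →L[ℝ] X)
    (hS0 : S 0 = ContinuousLinearMap.id ℝ X)
    (hSadd : ∀ a b : ℝ, 0 ≤ a → 0 ≤ b → S (a + b) = (S a).comp (S b))
    (hScont : ∀ x : X, ContinuousOn (fun σ => S σ x) (Set.Ici (0 : ℝ)))
    (U : Set (EuclideanSpace ℝ (Fin m))) (hUcpt : IsCompact U) (hUcvx : Convex ℝ U)
    (f : ℝ → X → X) (G : ℝ → X → EuclideanSpace ℝ (Fin m) →L[ℝ] X)
    {Mf MG : ℝ} (hMf : 0 ≤ Mf) (hMG : 0 ≤ MG)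
    (hfmeas : ∀ x : X,
      AEStronglyMeasurable (fun t => f t x) (volume.restrict (Set.Icc (0:ℝ) T)))
    (hGmeas : ∀ x : X,
      AEStronglyMeasurable (fun t => G t x) (volume.restrict (Set.Icc (0:ℝ) T)))
    (hA : ∀ᵐ t ∂(volume.restrict (Set.Icc (0:ℝ) T)),
        (∀ x y : X, ‖f t x - f t y‖ ≤ Mf * ‖x - y‖) ∧
        (∀ x y : X, ‖G t x - G t y‖ ≤ MG * ‖x - y‖) ∧
        ‖f t 0‖ ≤ Mf ∧ ‖G t 0‖ ≤ MG)
    {M : ℝ} (hM : 0 ≤ M)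
    (hDfmeas : ∀ x : X,
      AEStronglyMeasurable (fun t => fderiv ℝ (f t) x) (volume.restrict (Set.Icc (0:ℝ) T)))
    (hDGmeas : ∀ x : X,
      AEStronglyMeasurable (fun t => fderiv ℝ (G t) x) (volume.restrict (Set.Icc (0:ℝ) T)))
    (hAplus : ∀ᵐ t ∂(volume.restrict (Set.Icc (0:ℝ) T)),
        ContDiff ℝ 1 (f t) ∧ ContDiff ℝ 1 (G t) ∧
        (∀ x : X, ‖fderiv ℝ (f t) x‖ ≤ M) ∧
        (∀ x : X, ‖fderiv ℝ (G t) x‖ ≤ M) ∧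
        (∀ x y : X, ‖fderiv ℝ (f t) x - fderiv ℝ (f t) y‖ ≤ M * ‖x - y‖) ∧
        (∀ x y : X, ‖fderiv ℝ (G t) x - fderiv ℝ (G t) y‖ ≤ M * ‖x - y‖))
    (ubar : ℝ → EuclideanSpace ℝ (Fin m))
    (hubar_meas : AEStronglyMeasurable ubar (volume.restrict (Set.Icc (0:ℝ) T)))
    (hubar_mem : ∀ᵐ t ∂(volume.restrict (Set.Icc (0:ℝ) T)), ubar t ∈ U)
    (Φ : ℝ → ℝ → X → X)
    (hΦ : ∀ s ∈ Set.Icc (0:ℝ) T, ∀ x : X,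
      IsMildSol T S (fun τ y => f τ y + G τ y (ubar τ)) s x (fun t => Φ s t x))
    (ℓ : X → ℝ) (hℓ : ContDiff ℝ 1 ℓ)
    (hℓLip : ∀ B : Set X, Bornology.IsBounded B →
      ∃ K : ℝ, ∀ x ∈ B, ∀ y ∈ B, |ℓ x - ℓ y| ≤ K * ‖x - y‖)
    (u : ℝ → EuclideanSpace ℝ (Fin m))
    (hu_meas : AEStronglyMeasurable u (volume.restrict (Set.Icc (0:ℝ) T)))
    (hu_mem : ∀ᵐ t ∂(volume.restrict (Set.Icc (0:ℝ) T)), u t ∈ U)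
    (x₀ : X) (xu : ℝ → X)
    (hxu : IsMildSol T S (fun τ y => f τ y + G τ y (u τ)) 0 x₀ xu)
    (α : ℝ) (hα : 0 ≤ α) :
    (ℓ (xu T) + α / 2 * ∫ t in Set.Icc (0:ℝ) T, ‖u t‖ ^ 2) -
      (ℓ (Φ 0 T x₀) + α / 2 * ∫ t in Set.Icc (0:ℝ) T, ‖ubar t‖ ^ 2) =
    ∫ t in Set.Icc (0:ℝ) T,
      ((α / 2 * ‖u t‖ ^ 2 +
          fderiv ℝ (fun y => ℓ (Φ t T y)) (xu t) (G t (xu t) (u t))) -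
        (α / 2 * ‖ubar t‖ ^ 2 +
          fderiv ℝ (fun y => ℓ (Φ t T y)) (xu t) (G t (xu t) (ubar t)))) := by
  obtain ⟨R₀, hR₀⟩ := hUcpt.isBounded.exists_norm_le
  set R := max R₀ 0 with hRdef
  have hR : 0 ≤ R := le_max_right _ _
  have hRU : ∀ z ∈ U, ‖z‖ ≤ R := fun z hz => (hR₀ z hz).trans (le_max_left _ _)
  have huR : ∀ᵐ t ∂(volume.restrict (Set.Icc (0:ℝ) T)), ‖u t‖ ≤ R := hu_mem.mono fun t h => hRU _ h
  have hubR : ∀ᵐ t ∂(volume.restrict (Set.Icc (0:ℝ) T)), ‖ubar t‖ ≤ R :=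
    hubar_mem.mono fun t h => hRU _ h
  have gF := aux_good f G hMf hMG hM hR hfmeas hGmeas hA hAplus u hu_meas huR
  have gFb := aux_good f G hMf hMG hM hR hfmeas hGmeas hA hAplus ubar hubar_meas hubR
  obtain ⟨hi, he⟩ := aux_core hT (by positivity) hS0 hSadd hScont gF gFb hΦ
    (hℓ.differentiable (by norm_num)) hℓLip hxu
  have hsq : ∀ v : ℝ → EuclideanSpace ℝ (Fin m),
      AEStronglyMeasurable v (volume.restrict (Set.Icc (0:ℝ) T)) →
      (∀ᵐ t ∂(volume.restrict (Set.Icc (0:ℝ) T)), ‖v t‖ ≤ R) →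
      IntegrableOn (fun t => α / 2 * ‖v t‖ ^ 2) (Icc 0 T) := by
    intro v hv hvR
    refine Integrable.const_mul (Integrable.of_bound (hv.norm.pow 2) (R ^ 2) ?_) _
    filter_upwards [hvR] with t ht
    rw [Pi.pow_apply, norm_pow, norm_norm]
    gcongr
  have i1 := hsq u hu_meas huR
  have i2 := hsq ubar hubar_meas hubR
  rw [intervalIntegrable_iff_integrableOn_Icc_of_le hT.le] at hi
  rw [intervalIntegral.integral_of_le hT.le, ← integral_Icc_eq_integral_Ioc] at he
  have e1 : ∀ t, (α / 2 * ‖u t‖ ^ 2 +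
          fderiv ℝ (fun y => ℓ (Φ t T y)) (xu t) (G t (xu t) (u t))) -
        (α / 2 * ‖ubar t‖ ^ 2 +
          fderiv ℝ (fun y => ℓ (Φ t T y)) (xu t) (G t (xu t) (ubar t))) =
      (α / 2 * ‖u t‖ ^ 2 - α / 2 * ‖ubar t‖ ^ 2) +
        fderiv ℝ (fun y => ℓ (Φ t T y)) (xu t)
          (f t (xu t) + G t (xu t) (u t) - (f t (xu t) + G t (xu t) (ubar t))) := by
    intro t
    rw [add_sub_add_left_eq_sub, map_sub]
    ring
  simp_rw [e1]
  have i3 : Integrable (fun t => α / 2 * ‖u t‖ ^ 2 - α / 2 * ‖ubar t‖ ^ 2)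
      (volume.restrict (Icc (0:ℝ) T)) := i1.sub i2
  rw [integral_add i3 hi, integral_sub i1 i2, he, integral_const_mul,
    integral_const_mul]
  ring
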